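/- arXiv:math/0312402 — 4 statements merged into one kernel-verified Lean document; each statement's English description precedes it below -/
import Mathlib

section
/- Reversibility of the finite-volume Gaussian Gibbs measure for the heat-bath kernel (Theorem 5.1, finite-volume case): Let p be a symmetric translation-invariant finite-range stochastic matrix with zero diagonal on ℤ^d which is irreducible, let Λ ⊂ ℤ^d be finite, γ ∈ ℝ^{ℤ^d}, σ > 0, and let μ^{Λ,γ} be the finite-volume Gibbs measure. For k ∈ Λ let K_k be the Markov kernel on ℝ^Λ that maps η to the law of η^{k←η̄(k)+σX}, where X is a standard Gaussian random variable. Then μ^{Λ,γ} is reversible for K_k: the measure on ℝ^Λ × ℝ^Λ obtained by composing μ^{Λ,γ} with K_k (i.e., ∫ (δ_η ⊗ K_k(η)) μ^{Λ,γ}(dη)) is invariant under the coordinate swap (η, ξ) ↦ (ξ, η). In particular μ^{Λ,γ} is invariant for K_k. -/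
open MeasureTheory ProbabilityTheory

/-- The `n`-th matrix power of a (possibly infinite) kernel `p`. -/
noncomputable def matPow {α : Type*} (p : α → α → ℝ) : ℕ → α → α → ℝ
  | 0 => fun i j => haveI := Classical.propDecidable (i = j); if i = j then 1 else 0
  | n + 1 => fun i j => ∑' k, matPow p n i k * p k j

/-- Integrating against an affine image of the standard Gaussian, in density form. -/
theorem lintegral_gaussianReal_affine {σ : ℝ} (hσ : 0 < σ) (m : ℝ) {h : ℝ → ENNReal}
    (hh : Measurable h) :
    ∫⁻ x, h (m + σ * x) ∂gaussianReal 0 1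
      = ∫⁻ a, gaussianPDF m (NNReal.mk (σ ^ 2) (sq_nonneg σ)) a * h a := by
  have hv : NNReal.mk (σ ^ 2) (sq_nonneg σ) ≠ 0 := by
    intro h0
    exact (pow_pos hσ 2).ne' (congrArg NNReal.toReal h0)
  have hmap : Measure.map (fun x => m + σ * x) (gaussianReal 0 1)
      = gaussianReal m (NNReal.mk (σ ^ 2) (sq_nonneg σ)) := by
    have hcomp : (fun x : ℝ => m + σ * x) = (fun x => m + x) ∘ (fun x => σ * x) := rfl
    rw [hcomp, ← Measure.map_map (by fun_prop) (by fun_prop), gaussianReal_map_const_mul,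
      gaussianReal_map_const_add]
    simp
  rw [← lintegral_map hh (by fun_prop : Measurable fun x : ℝ => m + σ * x), hmap,
    gaussianReal_of_var_ne_zero _ hv,
    lintegral_withDensity_eq_lintegral_mul _ (measurable_gaussianPDF _ _) hh]
  rfl

section HeatBath

variable {ι : Type*} [DecidableEq ι] {k : ι} {σ : ℝ} {m : (ι → ℝ) → ℝ}

theorem measurable_heatBath (hm : Measurable m) (k : ι) (σ : ℝ) :
    Measurable fun q : (ι → ℝ) × ℝ => Function.update q.1 k (m q.1 + σ * q.2) :=
  measurable_update'.comp
    (measurable_fst.prodMk ((hm.comp measurable_fst).add (measurable_snd.const_mul σ)))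

variable [Fintype ι]

/-- Detailed balance for the heat-bath update, in integrated form: if the density `F` is, as a
function of the coordinate `k`, proportional to a Gaussian density with mean `m` and variance
`σ ^ 2`, then old and new configurations are exchangeable. -/
theorem lintegral_heatBath_swap {F : (ι → ℝ) → ENNReal} (hσ : 0 < σ) (hm : Measurable m)
    (hF : Measurable F) (hmk : ∀ η a, m (Function.update η k a) = m η)
    (hbal : ∀ η a b, F (Function.update η k b)
        * gaussianPDF (m η) (NNReal.mk (σ ^ 2) (sq_nonneg σ)) a
      = F (Function.update η k a) * gaussianPDF (m η) (NNReal.mk (σ ^ 2) (sq_nonneg σ)) b)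
    {g : (ι → ℝ) × (ι → ℝ) → ENNReal} (hg : Measurable g) :
    ∫⁻ η, ∫⁻ x, g (η, Function.update η k (m η + σ * x)) ∂gaussianReal 0 1
        ∂(volume.withDensity F)
      = ∫⁻ η, ∫⁻ x, g (Function.update η k (m η + σ * x), η) ∂gaussianReal 0 1
        ∂(volume.withDensity F) := by
  have hΦ := measurable_heatBath hm k σ
  have hI₁ : Measurable fun η =>
      ∫⁻ x, g (η, Function.update η k (m η + σ * x)) ∂gaussianReal 0 1 :=
    (hg.comp (measurable_fst.prodMk hΦ)).lintegral_prod_right'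
  have hI₂ : Measurable fun η =>
      ∫⁻ x, g (Function.update η k (m η + σ * x), η) ∂gaussianReal 0 1 :=
    (hg.comp (hΦ.prodMk measurable_fst)).lintegral_prod_right'
  rw [lintegral_withDensity_eq_lintegral_mul _ hF hI₁,
    lintegral_withDensity_eq_lintegral_mul _ hF hI₂]
  refine lintegral_eq_of_lmarginal_eq {k} (hF.mul hI₁) (hF.mul hI₂) ?_
  rw [lmarginal_singleton, lmarginal_singleton]
  funext η
  have hup : Measurable (Function.update η k) := measurable_update η
  set φ := gaussianPDF (m η) (NNReal.mk (σ ^ 2) (sq_nonneg σ)) with hφ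
  have hφm : Measurable φ := measurable_gaussianPDF _ _
  have hFm : Measurable fun b => F (Function.update η k b) := hF.comp hup
  have key : ∀ (G : (ι → ℝ) × (ι → ℝ) → ENNReal), Measurable G → ∀ b,
      F (Function.update η k b) * ∫⁻ x, G (Function.update η k b, Function.update
        (Function.update η k b) k (m (Function.update η k b) + σ * x)) ∂gaussianReal 0 1
      = ∫⁻ a, F (Function.update η k b) * φ a
          * G (Function.update η k b, Function.update η k a) := by
    intro G hG b
    have hGm : Measurable fun a => G (Function.update η k b, Function.update η k a) :=
      hG.comp (measurable_const.prodMk hup)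
    simp only [Function.update_idem, hmk]
    rw [lintegral_gaussianReal_affine hσ (m η) hGm]
    simp only [mul_assoc]
    exact (lintegral_const_mul _ (hφm.mul hGm)).symm
  have key₂ := key (g ∘ Prod.swap) (hg.comp measurable_swap)
  simp only [Function.comp_apply, Prod.swap_prod_mk] at key₂
  simp only [Pi.mul_apply]
  rw [lintegral_congr (key g hg), lintegral_congr key₂, lintegral_lintegral_swap]
  · simp only [hφ, hbal η]
  · exact (((hFm.comp measurable_fst).mul (hφm.comp measurable_snd)).mul
      (hg.comp ((hup.comp measurable_fst).prodMk (hup.comp measurable_snd)))).aemeasurable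

/-- Reversibility and invariance of `volume.withDensity F` for the heat-bath kernel. -/
theorem heatBath_reversible {F : (ι → ℝ) → ENNReal} (hσ : 0 < σ) (hm : Measurable m)
    (hF : Measurable F) (hmk : ∀ η a, m (Function.update η k a) = m η)
    (hbal : ∀ η a b, F (Function.update η k b)
        * gaussianPDF (m η) (NNReal.mk (σ ^ 2) (sq_nonneg σ)) a
      = F (Function.update η k a) * gaussianPDF (m η) (NNReal.mk (σ ^ 2) (sq_nonneg σ)) b)
    {K : (ι → ℝ) → Measure (ι → ℝ)}
    (hK : ∀ η, K η = Measure.map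
      (fun x : ℝ => Function.update η k (m η + σ * x)) (gaussianReal 0 1)) :
    Measure.map Prod.swap ((volume.withDensity F).bind
        fun η => Measure.map (fun ξ => (η, ξ)) (K η))
        = (volume.withDensity F).bind (fun η => Measure.map (fun ξ => (η, ξ)) (K η))
      ∧ (volume.withDensity F).bind K = volume.withDensity F := by
  have hΦ := measurable_heatBath hm k σ
  have hΦη : ∀ η, Measurable fun x : ℝ => Function.update η k (m η + σ * x) := fun η =>
    hΦ.comp (measurable_const.prodMk measurable_id)
  have hKm : Measurable K := by
    have : K = fun η => Measure.map (fun q : (ι → ℝ) × ℝ =>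
        Function.update q.1 k (m q.1 + σ * q.2))
        (Measure.map (Prod.mk η) (gaussianReal 0 1)) := by
      funext η
      rw [hK, Measure.map_map hΦ measurable_prodMk_left]
      rfl
    rw [this]
    exact (Measure.measurable_map _ hΦ).comp Measurable.map_prodMk_left
  have hJm : Measurable fun η => Measure.map (fun ξ => (η, ξ)) (K η) := by
    have : (fun η => Measure.map (fun ξ => (η, ξ)) (K η)) = fun η =>
        Measure.map (fun q : (ι → ℝ) × ℝ => (q.1, Function.update q.1 k (m q.1 + σ * q.2)))
        (Measure.map (Prod.mk η) (gaussianReal 0 1)) := by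
      funext η
      rw [hK, Measure.map_map measurable_prodMk_left (hΦη η),
        Measure.map_map (measurable_fst.prodMk hΦ) measurable_prodMk_left]
      rfl
    rw [this]
    exact (Measure.measurable_map _ (measurable_fst.prodMk hΦ)).comp Measurable.map_prodMk_left
  have hKint : ∀ η {h : (ι → ℝ) → ENNReal}, Measurable h → ∫⁻ ξ, h ξ ∂(K η)
      = ∫⁻ x, h (Function.update η k (m η + σ * x)) ∂gaussianReal 0 1 := fun η h hh => by
    rw [hK, lintegral_map hh (hΦη η)]
  have hJint : ∀ {g : (ι → ℝ) × (ι → ℝ) → ENNReal}, Measurable g →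
      ∫⁻ q, g q ∂((volume.withDensity F).bind fun η => Measure.map (fun ξ => (η, ξ)) (K η))
      = ∫⁻ η, ∫⁻ x, g (η, Function.update η k (m η + σ * x)) ∂gaussianReal 0 1
        ∂(volume.withDensity F) := fun {g} hg => by
    rw [Measure.lintegral_bind hJm.aemeasurable hg.aemeasurable]
    refine lintegral_congr fun η => ?_
    rw [lintegral_map hg measurable_prodMk_left]
    exact hKint η (hg.comp measurable_prodMk_left)
  constructor
  · refine Measure.ext_of_lintegral _ fun g hg => ?_
    rw [lintegral_map hg measurable_swap, hJint hg, lintegral_heatBath_swap hσ hm hF hmk hbal hg]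
    exact hJint (hg.comp measurable_swap)
  · refine Measure.ext_of_lintegral _ fun h hh => ?_
    rw [Measure.lintegral_bind hKm.aemeasurable hh.aemeasurable]
    simp only [hKint _ hh]
    rw [lintegral_heatBath_swap hσ hm hF hmk hbal (g := fun q => h q.2) (hh.comp measurable_snd)]
    simp

end HeatBath

/-- Change of the Dirichlet energy when the value at the single site `k` is changed. -/
theorem sum_energy_sub_of_eq_off {V : Type*} [DecidableEq V] {p : V → V → ℝ}
    (hsymm : ∀ i j, p i j = p j i) {k : V} (hdiag : p k k = 0) {S Λ : Finset V} (hkS : k ∈ S)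
    (hkΛ : k ∈ Λ) (hsum : ∑ j ∈ S, p k j = 1) {ω ω' : V → ℝ} (hω : ∀ j, j ≠ k → ω' j = ω j) :
    (∑ ij ∈ S ×ˢ S, if ij.1 ≠ ij.2 ∧ (ij.1 ∈ Λ ∨ ij.2 ∈ Λ)
        then p ij.1 ij.2 * (ω' ij.1 - ω' ij.2) ^ 2 else 0)
      - (∑ ij ∈ S ×ˢ S, if ij.1 ≠ ij.2 ∧ (ij.1 ∈ Λ ∨ ij.2 ∈ Λ)
        then p ij.1 ij.2 * (ω ij.1 - ω ij.2) ^ 2 else 0)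
      = 2 * ((ω' k - ∑ j ∈ S, p k j * ω j) ^ 2 - (ω k - ∑ j ∈ S, p k j * ω j) ^ 2) := by
  set q : V → ℝ := fun j => p k j * ((ω' k - ω j) ^ 2 - (ω k - ω j) ^ 2) with hq
  have hqk : q k = 0 := by simp [hq, hdiag]
  have hqsum : ∑ j ∈ S, q j
      = (ω' k - ∑ j ∈ S, p k j * ω j) ^ 2 - (ω k - ∑ j ∈ S, p k j * ω j) ^ 2 := by
    have : ∀ j, q j = (ω' k ^ 2 - ω k ^ 2) * p k j - 2 * (ω' k - ω k) * (p k j * ω j) :=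
      fun j => by simp only [hq]; ring
    simp only [this, Finset.sum_sub_distrib, ← Finset.mul_sum, hsum]
    ring
  rw [← Finset.sum_sub_distrib, ← hqsum]
  have hterm : ∀ ij ∈ S ×ˢ S, ((if ij.1 ≠ ij.2 ∧ (ij.1 ∈ Λ ∨ ij.2 ∈ Λ)
        then p ij.1 ij.2 * (ω' ij.1 - ω' ij.2) ^ 2 else 0)
      - (if ij.1 ≠ ij.2 ∧ (ij.1 ∈ Λ ∨ ij.2 ∈ Λ)
        then p ij.1 ij.2 * (ω ij.1 - ω ij.2) ^ 2 else 0))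
      = (if ij.1 = k then q ij.2 else 0) + (if ij.2 = k then q ij.1 else 0) := by
    rintro ⟨i, j⟩ -
    by_cases hi : i = k <;> by_cases hj : j = k
    · subst hi; subst hj; simp [hqk]
    · subst hi
      simp [hj, Ne.symm hj, hkΛ, hω j hj, hq]
      ring
    · subst hj
      simp [hi, hkΛ, hω i hi, hq, hsymm i j]
      ring
    · simp [hi, hj, hω i hi, hω j hj]
  rw [Finset.sum_congr rfl hterm, Finset.sum_add_distrib, Finset.sum_product, Finset.sum_product]
  simp [Finset.sum_ite_irrel, hkS]
  ring

/-- A translation-invariant finite-range kernel charges only finitely many sites from a finite set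
of starting points. -/
theorem exists_finset_supp_of_finite_range {d : ℕ} {p : (Fin d → ℤ) → (Fin d → ℤ) → ℝ}
    (htrans : ∀ i j, p i j = p 0 (j - i))
    (hrange : ∃ v : ℝ, ∀ j : Fin d → ℤ, v < ‖j‖ → p 0 j = 0) (Λ : Finset (Fin d → ℤ)) :
    ∃ S : Finset (Fin d → ℤ), Λ ⊆ S ∧ ∀ i ∈ Λ, ∀ j ∉ S, p i j = 0 := by
  obtain ⟨v, hv⟩ := hrange
  have hfin : (Metric.closedBall (0 : Fin d → ℤ) v).Finite :=
    (isCompact_closedBall _ _).finite_of_discrete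
  refine ⟨Λ ∪ (Λ ×ˢ hfin.toFinset).image (fun q => q.1 + q.2), Finset.subset_union_left,
    fun i hi j hj => ?_⟩
  rw [htrans]
  refine hv _ (lt_of_not_ge fun hle => hj ?_)
  refine Finset.mem_union_right _ (Finset.mem_image.2 ⟨(i, j - i), ?_, by simp⟩)
  simpa [hi] using hle

/-- Reversibility of the finite-volume Gaussian Gibbs measure for the heat-bath kernel
(Theorem 5.1, finite-volume case). -/
theorem stmt1 (d : ℕ) (hd : 1 ≤ d)
    (p : (Fin d → ℤ) → (Fin d → ℤ) → ℝ)
    (hnn : ∀ i j, 0 ≤ p i j)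
    (hstoch : ∀ i, ∑' j, p i j = 1)
    (hsymm : ∀ i j, p i j = p j i)
    (htrans : ∀ i j, p i j = p 0 (j - i))
    (hdiag : ∀ i, p i i = 0)
    (hrange : ∃ v : ℝ, ∀ j : Fin d → ℤ, v < ‖j‖ → p 0 j = 0)
    (hirr : ∀ i j, ∃ n : ℕ, 0 < matPow p n i j)
    (Λ : Finset (Fin d → ℤ)) (γ : (Fin d → ℤ) → ℝ) (σ : ℝ) (hσ : 0 < σ)
    -- `jux η` is the configuration equal to `η` on `Λ` and to `γ` off `Λ`
    (jux : (Λ → ℝ) → (Fin d → ℤ) → ℝ)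
    (hjux : ∀ η j, jux η j = if h : j ∈ Λ then η ⟨j, h⟩ else γ j)
    -- the Hamiltonian: the sum over unordered pairs of distinct sites meeting `Λ`
    -- is written as half the sum over ordered pairs
    (H : (Λ → ℝ) → ℝ)
    (hH : ∀ η, H η = (1 / (2 * σ ^ 2)) * ((1 / 2) *
      ∑' ij : ((Fin d → ℤ) × (Fin d → ℤ)),
        if ij.1 ≠ ij.2 ∧ (ij.1 ∈ Λ ∨ ij.2 ∈ Λ)
        then p ij.1 ij.2 * (jux η ij.1 - jux η ij.2) ^ 2 else 0))
    -- `etabar η k = ∑_j p(k,j) (η_Λ γ_{Λᶜ})(j)`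
    (etabar : (Λ → ℝ) → Λ → ℝ)
    (hbar : ∀ η k, etabar η k = ∑' j : Fin d → ℤ, p (k : Fin d → ℤ) j * jux η j)
    -- the partition function and the finite-volume Gibbs measure `μ^{Λ,γ}`
    (Z : ENNReal)
    (hZ : Z = ∫⁻ η : Λ → ℝ, ENNReal.ofReal (Real.exp (-(H η))))
    (μ : Measure (Λ → ℝ))
    (hμ : μ = volume.withDensity fun η => ENNReal.ofReal (Real.exp (-(H η))) / Z)
    (k : Λ)
    -- the heat-bath Markov kernel at site `k`
    (K : (Λ → ℝ) → Measure (Λ → ℝ))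
    (hK : ∀ η, K η = Measure.map
      (fun x : ℝ => Function.update η k (etabar η k + σ * x)) (gaussianReal 0 1)) :
    Measure.map Prod.swap (μ.bind fun η => Measure.map (fun ξ => (η, ξ)) (K η))
        = μ.bind (fun η => Measure.map (fun ξ => (η, ξ)) (K η))
      ∧ μ.bind K = μ := by
  obtain ⟨S, hΛS, hS⟩ := exists_finset_supp_of_finite_range htrans hrange Λ
  have hsumS : ∑ j ∈ S, p k j = 1 := by
    rw [← hstoch k]
    exact (tsum_eq_sum fun j hj => hS k k.2 j hj).symm
  have hbarS : ∀ η, etabar η k = ∑ j ∈ S, p k j * jux η j := fun η => by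
    rw [hbar]
    exact tsum_eq_sum fun j hj => by rw [hS k k.2 j hj, zero_mul]
  have hHS : ∀ η, H η = (1 / (2 * σ ^ 2)) * ((1 / 2) * ∑ ij ∈ S ×ˢ S,
      if ij.1 ≠ ij.2 ∧ (ij.1 ∈ Λ ∨ ij.2 ∈ Λ)
      then p ij.1 ij.2 * (jux η ij.1 - jux η ij.2) ^ 2 else 0) := fun η => by
    rw [hH, tsum_eq_sum (s := S ×ˢ S)]
    rintro ⟨i, j⟩ hij
    refine ite_eq_right_iff.2 fun hc => ?_
    suffices p i j = 0 by simp [this]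
    rw [Finset.mem_product, not_and_or] at hij
    rcases hc.2 with hi | hj
    · exact hS i hi j (hij.resolve_left (not_not.2 (hΛS hi)))
    · rw [hsymm]
      exact hS j hj i (hij.resolve_right (not_not.2 (hΛS hj)))
  have hjuxm : ∀ j, Measurable fun η => jux η j := fun j => by
    simp only [hjux]
    split_ifs
    · exact measurable_pi_apply _
    · exact measurable_const
  have hjuxk : ∀ η, jux η k = η k := fun η => by simp [hjux]
  have hjux_off : ∀ η a j, j ≠ (k : Fin d → ℤ) → jux (Function.update η k a) j = jux η j := by
    intro η a j hj
    rw [hjux, hjux]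
    split_ifs with h
    · exact Function.update_of_ne (fun he => hj (congrArg Subtype.val he)) _ _
    · rfl
  have hbarm : Measurable fun η => etabar η k := by
    simp only [hbarS]
    exact Finset.measurable_sum _ fun j _ => (hjuxm j).const_mul _
  have hHm : Measurable H := by
    rw [funext hHS]
    refine ((Finset.measurable_sum _ fun ij _ => ?_).const_mul _).const_mul _
    split_ifs
    · exact (((hjuxm _).sub (hjuxm _)).pow_const 2).const_mul _
    · exact measurable_const
  have hbark : ∀ η a, etabar (Function.update η k a) k = etabar η k := fun η a => by
    rw [hbarS, hbarS]
    refine Finset.sum_congr rfl fun j _ => ?_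
    by_cases hj : j = (k : Fin d → ℤ)
    · rw [hj, hdiag, zero_mul, zero_mul]
    · rw [hjux_off η a j hj]
  have hHdiff : ∀ η a, H (Function.update η k a) - H η
      = ((a - etabar η k) ^ 2 - (η k - etabar η k) ^ 2) / (2 * σ ^ 2) := fun η a => by
    have h := sum_energy_sub_of_eq_off hsymm (hdiag k) (hΛS k.2) k.2 hsumS (hjux_off η a)
    rw [hjuxk, hjuxk, Function.update_self, ← hbarS] at h
    rw [hHS, hHS, ← mul_sub, ← mul_sub, h]
    ring
  rw [hμ]
  refine heatBath_reversible hσ hbarm ?_ hbark ?_ hK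
  · exact (Real.measurable_exp.comp hHm.neg).ennreal_ofReal.div_const Z
  · intro η a b
    have ha := hHdiff η a
    have hb := hHdiff η b
    rw [gaussianPDF, gaussianPDF, ENNReal.mul_comm_div, ENNReal.mul_comm_div,
      mul_div_assoc', mul_div_assoc', ← ENNReal.ofReal_mul (Real.exp_nonneg _),
      ← ENNReal.ofReal_mul (Real.exp_nonneg _)]
    congr 2
    simp only [gaussianPDFReal, NNReal.coe_mk]
    rw [mul_left_comm, ← Real.exp_add, mul_left_comm, ← Real.exp_add]
    congr 2
    have hsub : H (Function.update η k a) - H (Function.update η k b)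
        = (a - etabar η k) ^ 2 / (2 * σ ^ 2) - (b - etabar η k) ^ 2 / (2 * σ ^ 2) := by
      rw [← sub_sub_sub_cancel_right _ _ (H η), ha, hb]
      ring
    rw [neg_div, neg_div]
    linarith
end

section
/- Detailed balance for the pinned free-boundary Gibbs measure (Lemma 5.3, one-site generators): In the pinned finite-volume setting, Z₀ := ∫_{ℝ^{V∖{0̂}}} e^{−H₀(η)} dη < ∞, and for every k ∈ V∖{0̂} and all bounded measurable f, g : ℝ^{V∖{0̂}} → ℝ one has ∫ e^{−H₀(η)} g(η) (∫_ℝ f(η^{k←η̄(k)+σx}) γ₁(dx)) dη = ∫ e^{−H₀(η)} f(η) (∫_ℝ g(η^{k←η̄(k)+σx}) γ₁(dx)) dη, where η^{k←a} denotes η with its k-th coordinate replaced by a. -/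
open MeasureTheory ProbabilityTheory

/-- A linear involution of a finite-dimensional real space preserves every additive Haar measure. -/
theorem LinearMap.measurePreserving_of_involutive {E : Type*} [NormedAddCommGroup E]
    [NormedSpace ℝ E] [MeasurableSpace E] [BorelSpace E] [FiniteDimensional ℝ E]
    (μ : Measure E) [μ.IsAddHaarMeasure] (T : E →ₗ[ℝ] E) (hT : Function.Involutive T) :
    MeasurePreserving T μ μ := by
  have hdet : LinearMap.det T * LinearMap.det T = 1 := by
    rw [← LinearMap.det_comp, show T ∘ₗ T = LinearMap.id from LinearMap.ext hT, LinearMap.det_id]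
  have habs : |(LinearMap.det T)⁻¹| = 1 := by
    rcases mul_self_eq_one_iff.mp hdet with h | h <;> simp [h]
  refine ⟨T.continuous_of_finiteDimensional.measurable, ?_⟩
  rw [Measure.map_linearMap_addHaar_eq_smul_addHaar μ (left_ne_zero_of_mul_eq_one hdet), habs]
  simp

section ExchangeCoordinate

variable {ι : Type*} [DecidableEq ι]

/-- Exchange the `k`-th coordinate of `η` with an extra real coordinate. -/
def exchangeCoordinate (k : ι) : (ι → ℝ) × ℝ →ₗ[ℝ] (ι → ℝ) × ℝ where
  toFun p := (Function.update p.1 k p.2, p.1 k)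
  map_add' p r := by
    ext i
    · by_cases h : i = k
      · subst h; simp
      · simp [h]
    · simp
  map_smul' c p := by
    ext i
    · by_cases h : i = k
      · subst h; simp
      · simp [h]
    · simp

theorem exchangeCoordinate_apply (k : ι) (p : (ι → ℝ) × ℝ) :
    exchangeCoordinate k p = (Function.update p.1 k p.2, p.1 k) := rfl

theorem exchangeCoordinate_involutive (k : ι) : Function.Involutive (exchangeCoordinate k) := by
  intro p
  simp [exchangeCoordinate_apply]

theorem integral_comp_exchangeCoordinate [Fintype ι] (k : ι) (F : (ι → ℝ) × ℝ → ℝ) :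
    ∫ p, F (exchangeCoordinate k p) ∂((volume : Measure (ι → ℝ)).prod volume)
      = ∫ p, F p ∂((volume : Measure (ι → ℝ)).prod volume) := by
  have hT := LinearMap.measurePreserving_of_involutive
    ((volume : Measure (ι → ℝ)).prod (volume : Measure ℝ)) (exchangeCoordinate k)
    (exchangeCoordinate_involutive k)
  have hinv := exchangeCoordinate_involutive k
  let e : ((ι → ℝ) × ℝ) ≃ᵐ ((ι → ℝ) × ℝ) :=
    { toEquiv := hinv.toPerm
      measurable_toFun := hT.measurable
      measurable_invFun := hT.measurable }
  exact hT.integral_comp e.measurableEmbedding F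

end ExchangeCoordinate

/-- Integration against a nondegenerate affine image of the standard Gaussian. -/
theorem integral_gaussianReal_affine {σ : ℝ} (hσ : 0 < σ) (m : ℝ) {φ : ℝ → ℝ}
    (hφ : Measurable φ) :
    ∫ x, φ (m + σ * x) ∂(gaussianReal 0 1)
      = ∫ y, gaussianPDFReal m (σ ^ 2).toNNReal y * φ y := by
  have hmap : (gaussianReal 0 1).map (fun x => m + σ * x)
      = gaussianReal m (σ ^ 2).toNNReal := by
    have hcomp : (fun x => m + σ * x) = (m + ·) ∘ (σ * ·) := rfl
    rw [hcomp, ← Measure.map_map (by fun_prop) (by fun_prop), gaussianReal_map_const_mul,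
      gaussianReal_map_const_add, Real.toNNReal_of_nonneg (sq_nonneg σ)]
    simp only [mul_zero, zero_add, mul_one]
  rw [← integral_map (φ := fun x => m + σ * x) (by fun_prop) hφ.aestronglyMeasurable, hmap,
    integral_gaussianReal_eq_integral_smul (by simpa using hσ.ne')]
  simp

section HeatBath

variable {ι : Type*} [Fintype ι] {σ : ℝ} {H m : (ι → ℝ) → ℝ} {k : ι}

theorem integrable_exp_neg_mul_gaussianPDFReal (hσ : 0 < σ) (hHm : Measurable H)
    (hmm : Measurable m) (hint : Integrable (fun η => Real.exp (-(H η)))) :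
    Integrable (fun p : (ι → ℝ) × ℝ =>
      Real.exp (-(H p.1)) * gaussianPDFReal (m p.1) (σ ^ 2).toNNReal p.2)
      ((volume : Measure (ι → ℝ)).prod volume) := by
  have hv : (σ ^ 2).toNNReal ≠ 0 := by simpa using hσ.ne'
  have hmeas : Measurable (fun p : (ι → ℝ) × ℝ =>
      Real.exp (-(H p.1)) * gaussianPDFReal (m p.1) (σ ^ 2).toNNReal p.2) := by
    unfold gaussianPDFReal
    fun_prop
  refine (integrable_prod_iff hmeas.aestronglyMeasurable).mpr
    ⟨.of_forall fun η => (integrable_gaussianPDFReal (m η) (σ ^ 2).toNNReal).const_mul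
      (Real.exp (-(H η))), ?_⟩
  simpa [abs_of_nonneg (gaussianPDFReal_nonneg _ _ _), integral_const_mul,
    integral_gaussianPDFReal_eq_one _ hv] using hint

variable [DecidableEq ι]

/-- The heat-bath expectation written as an integral over `(ι → ℝ) × ℝ`. -/
theorem integral_heatBath_eq_integral_prod (hσ : 0 < σ) (hHm : Measurable H) (hmm : Measurable m)
    (hint : Integrable (fun η => Real.exp (-(H η)))) {f g : (ι → ℝ) → ℝ}
    (hf : Measurable f) (hg : Measurable g) (hfb : ∃ C, ∀ η, |f η| ≤ C)
    (hgb : ∃ C, ∀ η, |g η| ≤ C) :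
    ∫ η, Real.exp (-(H η)) * g η *
        (∫ x, f (Function.update η k (m η + σ * x)) ∂(gaussianReal 0 1))
      = ∫ p : (ι → ℝ) × ℝ, (Real.exp (-(H p.1)) * gaussianPDFReal (m p.1) (σ ^ 2).toNNReal p.2) *
          (g p.1 * f (Function.update p.1 k p.2)) ∂((volume : Measure (ι → ℝ)).prod volume) := by
  obtain ⟨C, hC⟩ := hfb
  obtain ⟨D, hD⟩ := hgb
  have hupd : Measurable fun p : (ι → ℝ) × ℝ => Function.update p.1 k p.2 :=
    measurable_fst.comp (exchangeCoordinate k).continuous_of_finiteDimensional.measurable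
  have hI := (integrable_exp_neg_mul_gaussianPDFReal hσ hHm hmm hint).mul_bdd
    (g := fun p : (ι → ℝ) × ℝ => g p.1 * f (Function.update p.1 k p.2)) (c := D * C)
    ((hg.comp measurable_fst).mul (hf.comp hupd)).aestronglyMeasurable
    (.of_forall fun p => by
      rw [Real.norm_eq_abs, abs_mul]
      exact mul_le_mul (hD _) (hC _) (abs_nonneg _) ((abs_nonneg _).trans (hD p.1)))
  rw [integral_prod _ hI]
  refine integral_congr_ae (.of_forall fun η => ?_)
  simp only
  rw [integral_gaussianReal_affine hσ (m η) (φ := fun y => f (Function.update η k y))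
    (hf.comp (measurable_update η)), ← integral_const_mul]
  congr 1 with y
  ring

/-- Detailed balance for the heat-bath dynamics at `k`, when the conditional law of the `k`-th
coordinate under `exp (-H)` is Gaussian with mean `m` and variance `σ ^ 2`. -/
theorem heatBath_detailed_balance (hσ : 0 < σ) (hHm : Measurable H) (hmm : Measurable m)
    (hint : Integrable (fun η => Real.exp (-(H η))))
    (hmk : ∀ η y, m (Function.update η k y) = m η)
    (hHk : ∀ η y, H (Function.update η k y)
      = H η + ((y - m η) ^ 2 - (η k - m η) ^ 2) / (2 * σ ^ 2))
    {f g : (ι → ℝ) → ℝ} (hf : Measurable f) (hg : Measurable g) (hfb : ∃ C, ∀ η, |f η| ≤ C)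
    (hgb : ∃ C, ∀ η, |g η| ≤ C) :
    ∫ η, Real.exp (-(H η)) * g η *
        (∫ x, f (Function.update η k (m η + σ * x)) ∂(gaussianReal 0 1))
      = ∫ η, Real.exp (-(H η)) * f η *
        (∫ x, g (Function.update η k (m η + σ * x)) ∂(gaussianReal 0 1)) := by
  rw [integral_heatBath_eq_integral_prod hσ hHm hmm hint hf hg hfb hgb,
    integral_heatBath_eq_integral_prod hσ hHm hmm hint hg hf hgb hfb,
    ← integral_comp_exchangeCoordinate k]
  congr 1 with p
  have hw : Real.exp (-(H (Function.update p.1 k p.2)))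
        * gaussianPDFReal (m p.1) (σ ^ 2).toNNReal (p.1 k)
      = Real.exp (-(H p.1)) * gaussianPDFReal (m p.1) (σ ^ 2).toNNReal p.2 := by
    simp only [gaussianPDFReal, hHk, Real.coe_toNNReal _ (sq_nonneg σ)]
    rw [mul_left_comm, mul_left_comm (Real.exp (-(H p.1))), ← Real.exp_add, ← Real.exp_add]
    congr 2
    ring
  simp only [exchangeCoordinate_apply, hmk, hw, Function.update_idem, Function.update_eq_self]
  ring

end HeatBath

/-- A continuous, positive definite, 2-homogeneous function has an integrable Gibbs weight. -/
theorem integrable_exp_neg_of_homogeneous {ι : Type*} [Fintype ι] {H : (ι → ℝ) → ℝ}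
    (hc : Continuous H) (hsmul : ∀ (c : ℝ) η, H (c • η) = c ^ 2 * H η)
    (hpos : ∀ η, η ≠ 0 → 0 < H η) :
    Integrable (fun η => Real.exp (-(H η))) := by
  have hH0 : H 0 = 0 := by simpa using hsmul 0 0
  obtain ⟨b, hb, hbH⟩ : ∃ b > 0, ∀ η, b * ∑ i, η i ^ 2 ≤ H η := by
    rcases isEmpty_or_nonempty ι with hι | hι
    · exact ⟨1, one_pos, fun η => by simp [Subsingleton.elim η 0, hH0]⟩
    obtain ⟨e, he, hmin⟩ := (isCompact_sphere (0 : ι → ℝ) 1).exists_isMinOn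
      (NormedSpace.sphere_nonempty.mpr zero_le_one) hc.continuousOn
    have he0 : e ≠ 0 := by
      rintro rfl
      simp at he
    have hcard : (0 : ℝ) < Fintype.card ι := by exact_mod_cast Fintype.card_pos
    refine ⟨H e / Fintype.card ι, div_pos (hpos e he0) hcard, fun η => ?_⟩
    rcases eq_or_ne η 0 with rfl | hη
    · simp [hH0]
    have hn : 0 < ‖η‖ := norm_pos_iff.mpr hη
    have hmem : ‖η‖⁻¹ • η ∈ Metric.sphere (0 : ι → ℝ) 1 := by
      simp [norm_smul, hn.ne']
    have hsum : ∑ i, η i ^ 2 ≤ Fintype.card ι * ‖η‖ ^ 2 := by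
      refine (Finset.sum_le_card_nsmul _ _ (‖η‖ ^ 2) fun i _ => ?_).trans (by simp)
      exact sq_le_sq.mpr (by simpa using norm_le_pi_norm η i)
    calc H e / Fintype.card ι * ∑ i, η i ^ 2
        ≤ H e / Fintype.card ι * (Fintype.card ι * ‖η‖ ^ 2) :=
          mul_le_mul_of_nonneg_left hsum (div_pos (hpos e he0) hcard).le
      _ = ‖η‖ ^ 2 * H e := by field_simp
      _ ≤ ‖η‖ ^ 2 * H (‖η‖⁻¹ • η) := mul_le_mul_of_nonneg_left (hmin hmem) (by positivity)
      _ = H η := by rw [← hsmul, smul_inv_smul₀ hn.ne']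
  have hprod : Integrable (fun η : ι → ℝ => ∏ i, Real.exp (-b * η i ^ 2)) :=
    Integrable.fintype_prod fun _ => integrable_exp_neg_mul_sq hb
  refine hprod.mono' (by fun_prop) (.of_forall fun η => ?_)
  rw [Real.norm_eq_abs, Real.abs_exp, ← Real.exp_sum, ← Finset.mul_sum, Real.exp_le_exp]
  linarith [hbH η]

section DirichletForm

variable {V : Type*} [Fintype V] [DecidableEq V] {q : Matrix V V ℝ}

/-- The effect of changing one value on the Dirichlet form of a symmetric stochastic matrix. -/
theorem dirichletForm_update (hstoch : ∀ i, ∑ j, q i j = 1) (hsymm : ∀ i j, q i j = q j i)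
    (hdiag : ∀ i, q i i = 0) (u : V → ℝ) (k : V) (y : ℝ) :
    ∑ i, ∑ j, q i j * (Function.update u k y i - Function.update u k y j) ^ 2
      = ∑ i, ∑ j, q i j * (u i - u j) ^ 2
        + 2 * ((y - ∑ j, q k j * u j) ^ 2 - (u k - ∑ j, q k j * u j) ^ 2) := by
  set t := y - u k with ht
  have hupd : ∀ i, Function.update u k y i = u i + t * (if i = k then 1 else 0) := by
    intro i
    by_cases h : i = k
    · subst h; simp [ht]
    · simp [h]
  have hexp : ∀ i j, q i j * (Function.update u k y i - Function.update u k y j) ^ 2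
      = q i j * (u i - u j) ^ 2
        + (if i = k then 2 * t * (q k j * (u k - u j)) + t ^ 2 * q k j else 0)
        + (if j = k then 2 * t * (q k i * (u k - u i)) + t ^ 2 * q k i else 0) := by
    intro i j
    rw [hupd, hupd]
    by_cases hi : i = k <;> by_cases hj : j = k
    · subst hi; subst hj; simp [hdiag]
    · subst hi; simp [hj]; ring
    · subst hj; simp [hi, hsymm i j]; ring
    · simp [hi, hj]
  have hrow : ∑ j, (2 * t * (q k j * (u k - u j)) + t ^ 2 * q k j)
      = 2 * t * (u k - ∑ j, q k j * u j) + t ^ 2 := by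
    simp only [Finset.sum_add_distrib, ← Finset.mul_sum, mul_sub, Finset.sum_sub_distrib,
      ← Finset.sum_mul, hstoch]
    ring
  simp only [hexp, Finset.sum_add_distrib, Finset.sum_ite_eq', Finset.mem_univ, if_true]
  rw [Finset.sum_comm (f := fun i j => if i = k then _ else _)]
  simp only [Finset.sum_ite_eq', Finset.mem_univ, if_true]
  simp only [← Finset.sum_add_distrib, hrow]
  rw [ht]
  ring

/-- A function with vanishing Dirichlet form is constant along paths of positive weight. -/
theorem eq_of_dirichletForm_eq_zero (hnn : ∀ i j, 0 ≤ q i j) {u : V → ℝ}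
    (hu : ∑ i, ∑ j, q i j * (u i - u j) ^ 2 = 0) (n : ℕ) :
    ∀ i j, 0 < (q ^ n) i j → u i = u j := by
  have hterm : ∀ i j, 0 ≤ q i j * (u i - u j) ^ 2 := fun i j => mul_nonneg (hnn i j) (sq_nonneg _)
  have hstep : ∀ i j, q i j ≠ 0 → u i = u j := by
    intro i j hij
    have hi := (Finset.sum_eq_zero_iff_of_nonneg
      fun i _ => Finset.sum_nonneg fun j _ => hterm i j).mp hu i (Finset.mem_univ i)
    have hj := (Finset.sum_eq_zero_iff_of_nonneg fun j _ => hterm i j).mp hi j (Finset.mem_univ j)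
    simpa [hij, sub_eq_zero] using hj
  induction n with
  | zero =>
    intro i j h
    by_contra hne
    simp [show i ≠ j from fun h => hne (h ▸ rfl)] at h
  | succ n ih =>
    intro i j h
    have hqn : ∀ i j, 0 ≤ (q ^ n) i j := by
      clear ih h
      induction n with
      | zero => intro i j; rw [pow_zero, Matrix.one_apply]; positivity
      | succ n ihn =>
        intro i j
        rw [pow_succ, Matrix.mul_apply]
        exact Finset.sum_nonneg fun l _ => mul_nonneg (ihn i l) (hnn l j)
    rw [pow_succ, Matrix.mul_apply] at h
    obtain ⟨l, -, hl⟩ := Finset.exists_ne_zero_of_sum_ne_zero h.ne'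
    exact (ih i l ((hqn i l).lt_of_ne' (left_ne_zero_of_mul hl))).trans
      (hstep l j (right_ne_zero_of_mul hl))

end DirichletForm

/-- Detailed balance for the pinned free-boundary Gibbs measure
(Lemma 5.3, one-site generators): finiteness of `Z₀` and the detailed balance identity. -/
theorem stmt2 (V : Type) [Fintype V] [DecidableEq V] (v₀ : V) (σ : ℝ) (hσ : 0 < σ)
    (q : Matrix V V ℝ)
    (hnn : ∀ i j, 0 ≤ q i j)
    (hstoch : ∀ i, ∑ j, q i j = 1)
    (hsymm : ∀ i j, q i j = q j i)
    (hdiag : ∀ i, q i i = 0)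
    (hirr : ∀ i j, ∃ n : ℕ, 0 < (q ^ n) i j)
    -- `ext η` is the extension `η̂` of `η` to `V` with `η̂ v₀ = 0`
    (ext : ({v : V // v ≠ v₀} → ℝ) → V → ℝ)
    (hext : ∀ η v, ext η v = if h : v = v₀ then 0 else η ⟨v, h⟩)
    -- the pinned Hamiltonian: the sum over unordered pairs of distinct points of `V`
    -- is written as half the sum over ordered pairs
    (H₀ : ({v : V // v ≠ v₀} → ℝ) → ℝ)
    (hH : ∀ η, H₀ η = (1 / (2 * σ ^ 2)) * ((1 / 2) *
      ∑ i : V, ∑ j : V,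
        if i ≠ j then q i j * (ext η i - ext η j) ^ 2 else 0))
    -- `etabar η k = ∑_j q(k,j) η̂(j)`
    (etabar : ({v : V // v ≠ v₀} → ℝ) → V → ℝ)
    (hbar : ∀ η k, etabar η k = ∑ j, q k j * ext η j) :
    Integrable (fun η : {v : V // v ≠ v₀} → ℝ => Real.exp (-(H₀ η)))
      ∧ ∀ (k : {v : V // v ≠ v₀}) (f g : ({v : V // v ≠ v₀} → ℝ) → ℝ),
        Measurable f → Measurable g →
        (∃ C, ∀ η, |f η| ≤ C) → (∃ C, ∀ η, |g η| ≤ C) →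
        ∫ η : {v : V // v ≠ v₀} → ℝ, Real.exp (-(H₀ η)) * g η *
            (∫ x, f (Function.update η k (etabar η (k : V) + σ * x)) ∂(gaussianReal 0 1))
          = ∫ η : {v : V // v ≠ v₀} → ℝ, Real.exp (-(H₀ η)) * f η *
            (∫ x, g (Function.update η k (etabar η (k : V) + σ * x)) ∂(gaussianReal 0 1)) := by
  have hH' : ∀ η, H₀ η = (1 / (4 * σ ^ 2)) * ∑ i, ∑ j, q i j * (ext η i - ext η j) ^ 2 := by
    intro η
    have hite : ∀ i j, (if i ≠ j then q i j * (ext η i - ext η j) ^ 2 else 0)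
        = q i j * (ext η i - ext η j) ^ 2 := by
      intro i j
      by_cases h : i = j <;> simp [h]
    simp only [hH, hite]
    ring
  have hextc : ∀ v, Continuous fun η => ext η v := by
    intro v
    simp only [hext]
    split_ifs <;> fun_prop
  have hextk : ∀ (k : {v : V // v ≠ v₀}) η, ext η k = η k := by
    intro k η
    simp [hext, k.2]
  have hextu : ∀ (k : {v : V // v ≠ v₀}) η y,
      ext (Function.update η k y) = Function.update (ext η) k y := by
    intro k η y
    funext v
    by_cases hv : v = v₀
    · simp [hext, hv, k.2.symm]
    · by_cases hk : v = k
      · subst hk; simp [hextk]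
      · have hk' : (⟨v, hv⟩ : {v : V // v ≠ v₀}) ≠ k := fun h => hk (congrArg Subtype.val h)
        simp [hext, hv, hk, hk']
  have hHc : Continuous H₀ := by
    rw [funext hH']
    fun_prop
  have hbarc : ∀ k, Continuous fun η => etabar η k := by
    intro k
    simp only [hbar]
    fun_prop
  have hint : Integrable (fun η : {v : V // v ≠ v₀} → ℝ => Real.exp (-(H₀ η))) := by
    refine integrable_exp_neg_of_homogeneous hHc (fun c η => ?_) (fun η hη => ?_)
    · have hc : ∀ v, ext (c • η) v = c * ext η v := by
        intro v
        by_cases hv : v = v₀ <;> simp [hext, hv]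
      simp only [hH', hc, ← mul_sub, mul_pow, mul_left_comm _ (c ^ 2), ← Finset.mul_sum]
    · rw [hH']
      refine mul_pos (by positivity) (lt_of_le_of_ne
        (Finset.sum_nonneg fun i _ => Finset.sum_nonneg fun j _ =>
          mul_nonneg (hnn i j) (sq_nonneg _)) fun h0 => hη ?_)
      funext k
      obtain ⟨n, hn⟩ := hirr k v₀
      have h := eq_of_dirichletForm_eq_zero hnn h0.symm n k v₀ hn
      rw [hextk] at h
      simp [h, hext]
  refine ⟨hint, fun k f g hf hg hfb hgb => ?_⟩
  refine heatBath_detailed_balance (m := fun η => etabar η k) hσ hHc.measurable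
    (hbarc k).measurable hint (fun η y => ?_) (fun η y => ?_) hf hg hfb hgb
  · simp only [hbar, hextu]
    refine Finset.sum_congr rfl fun j _ => ?_
    by_cases hj : j = k
    · simp [hj, hdiag]
    · simp [hj]
  · rw [hH', hH', hextu, dirichletForm_update hstoch hsymm hdiag, hbar, hextk]
    field_simp
    ring
end

section
/- The finite-volume Gaussian Gibbs measure is a harness: Let p be a symmetric translation-invariant finite-range stochastic matrix with zero diagonal on ℤ^d which is irreducible, let Λ ⊂ ℤ^d be finite, γ ∈ ℝ^{ℤ^d}, σ > 0, and let μ^{Λ,γ} be the finite-volume Gibbs measure. Then for every k ∈ Λ the coordinate function η ↦ η(k) is μ^{Λ,γ}-integrable and its conditional expectation given the σ-algebra generated by the coordinates (η(j) : j ∈ Λ∖{k}) satisfies E_{μ^{Λ,γ}}[η(k) | η(j), j ∈ Λ∖{k}] = ∑_{j∈ℤ^d} p(k,j)(η_Λγ_{Λ^c})(j) μ^{Λ,γ}-almost surely. -/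
open MeasureTheory ProbabilityTheory

namespace Harness

section Reflection

variable {ι : Type*} [DecidableEq ι] {k : ι}

/-- Reflection of the `k`-th coordinate about a value `G` depending on the other coordinates. -/
def reflect (k : ι) (G : ({j : ι // j ≠ k} → ℝ) → ℝ) (η : ι → ℝ) : ι → ℝ :=
  Function.update η k (2 * G (fun j => η j) - η k)

lemma measurable_reflect {G : ({j : ι // j ≠ k} → ℝ) → ℝ} (hG : Measurable G) :
    Measurable (reflect k G) := by
  refine measurable_pi_lambda _ fun i => ?_
  by_cases h : i = k
  · subst h
    simp only [reflect, Function.update_self]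
    exact ((hG.comp (measurable_pi_lambda _ fun j => measurable_pi_apply _)).const_mul 2).sub
      (measurable_pi_apply _)
  · simp only [reflect, Function.update_of_ne h]
    exact measurable_pi_apply _

lemma reflect_restrict (G : ({j : ι // j ≠ k} → ℝ) → ℝ) (η : ι → ℝ) :
    (fun j : {j : ι // j ≠ k} => reflect k G η j) = fun j : {j : ι // j ≠ k} => η j := by
  funext j
  simp [reflect, j.2]

lemma volume_preserving_reflect [Fintype ι] {G : ({j : ι // j ≠ k} → ℝ) → ℝ} (hG : Measurable G) :
    MeasurePreserving (reflect k G) volume volume := by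
  let e := MeasurableEquiv.piEquivPiSubtypeProd (fun _ : ι => ℝ) (fun j => j ≠ k)
  have he : MeasurePreserving e volume volume :=
    volume_preserving_piEquivPiSubtypeProd (fun _ : ι => ℝ) (fun j => j ≠ k)
  have hS : MeasurePreserving
      (fun q : ({j : ι // j ≠ k} → ℝ) × ({j : ι // ¬ j ≠ k} → ℝ) =>
        (q.1, (fun _ => 2 * G q.1) - q.2)) volume volume := by
    refine (MeasurePreserving.id volume).skew_product
      (g := fun y z => (fun _ => 2 * G y) - z) ?_ ?_
    · refine Measurable.sub (measurable_pi_lambda _ fun _ => ?_) measurable_snd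
      exact (hG.comp measurable_fst).const_mul 2
    · exact Filter.Eventually.of_forall fun y =>
        (Measure.measurePreserving_sub_left volume _).map_eq
  convert he.symm.comp (hS.comp he) using 1
  funext η i
  by_cases h : i = k
  · subst h
    simp [reflect, e, MeasurableEquiv.piEquivPiSubtypeProd, Equiv.piEquivPiSubtypeProd]
  · simp [reflect, e, MeasurableEquiv.piEquivPiSubtypeProd, Equiv.piEquivPiSubtypeProd, h]

lemma _root_.MeasureTheory.MeasurePreserving.withDensity_of_comp_eq {α : Type*}
    [MeasurableSpace α] {ν : Measure α} {T : α → α} (hT : MeasurePreserving T ν ν)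
    {f : α → ENNReal} (hf : Measurable f) (hfT : ∀ x, f (T x) = f x) :
    MeasurePreserving T (ν.withDensity f) (ν.withDensity f) := by
  refine ⟨hT.measurable, Measure.ext fun s hs => ?_⟩
  rw [Measure.map_apply hT.measurable hs, withDensity_apply _ (hT.measurable hs),
    withDensity_apply _ hs, ← hT.setLIntegral_comp_preimage hs hf]
  simp only [hfT]

/-- A finite measure invariant under reflecting the `k`-th coordinate about a function of the
other coordinates has this function as the conditional expectation of the `k`-th coordinate. -/
lemma condExp_eval_of_reflect {μ : Measure (ι → ℝ)} [IsFiniteMeasure μ]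
    {G : ({j : ι // j ≠ k} → ℝ) → ℝ} (hG : Measurable G)
    (hT : MeasurePreserving (reflect k G) μ μ) (hint : Integrable (fun η : ι → ℝ => η k) μ) :
    μ[(fun η : ι → ℝ => η k) | MeasurableSpace.comap
      (fun (η : ι → ℝ) (j : {j : ι // j ≠ k}) => η (j : ι)) inferInstance]
      =ᵐ[μ] fun η => G (fun j => η j) := by
  have hr : Measurable (fun (η : ι → ℝ) (j : {j : ι // j ≠ k}) => η (j : ι)) :=
    measurable_pi_lambda _ fun j => measurable_pi_apply _
  have hintT : Integrable (fun η => reflect k G η k) μ := hT.integrable_comp_of_integrable hint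
  have hval : ∀ η : ι → ℝ, reflect k G η k = 2 * G (fun j => η j) - η k := fun η => by
    simp [reflect]
  have hGint : Integrable (fun η : ι → ℝ => G (fun j => η j)) μ := by
    convert (hint.add hintT).const_mul (1 / 2) using 1
    funext η
    simp only [Pi.add_apply, hval]
    ring
  refine (ae_eq_condExp_of_forall_setIntegral_eq hr.comap_le hint
    (fun s _ _ => hGint.integrableOn) ?_ ?_).symm
  · rintro _ ⟨A, hA, rfl⟩ -
    set s := (fun (η : ι → ℝ) (j : {j : ι // j ≠ k}) => η (j : ι)) ⁻¹' A with hs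
    have hTs : reflect k G ⁻¹' s = s := by
      ext η
      simp only [hs, Set.mem_preimage, reflect_restrict]
    have key : ∫ η in s, η k ∂μ = ∫ η in s, (2 * G (fun j => η j) - η k) ∂μ := by
      conv_lhs => rw [← hT.map_eq]
      rw [setIntegral_map (hr hA) (measurable_pi_apply k).aestronglyMeasurable
        hT.measurable.aemeasurable, hTs]
      simp only [hval]
    rw [integral_sub (hGint.integrableOn.const_mul 2) hint.integrableOn,
      integral_const_mul] at key
    linarith
  · exact (hG.comp (comap_measurable _)).aestronglyMeasurable

end Reflection

section Coercive

lemma integrable_of_norm_le_gaussian {ι : Type*} [Fintype ι] {f : (ι → ℝ) → ℝ}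
    (hf : AEStronglyMeasurable f volume) {b C : ℝ} (hb : 0 < b)
    (h : ∀ η, ‖f η‖ ≤ C * Real.exp (-(b * ‖η‖ ^ 2))) : Integrable f := by
  rcases isEmpty_or_nonempty ι with hι | hι
  · exact Integrable.of_finite
  have hn : (0 : ℝ) < Fintype.card ι := by exact_mod_cast Fintype.card_pos
  have hprod : Integrable (fun η : ι → ℝ =>
      C * ∏ i, Real.exp (-(b / Fintype.card ι) * η i ^ 2)) :=
    (Integrable.fintype_prod (f := fun _ x => Real.exp (-(b / Fintype.card ι) * x ^ 2))
      fun _ => integrable_exp_neg_mul_sq (by positivity)).const_mul C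
  have hC : 0 ≤ C := by
    have := (norm_nonneg _).trans (h 0)
    simpa using this
  refine hprod.mono' hf (Filter.Eventually.of_forall fun η => (h η).trans ?_)
  rw [← Real.exp_sum, ← Finset.mul_sum]
  gcongr
  have : ∑ i, η i ^ 2 ≤ Fintype.card ι * ‖η‖ ^ 2 := by
    calc ∑ i, η i ^ 2 ≤ ∑ _i : ι, ‖η‖ ^ 2 := Finset.sum_le_sum fun i _ => by
          rw [← sq_abs]
          gcongr
          exact norm_le_pi_norm η i
      _ = _ := by simp
  have := mul_le_mul_of_nonneg_left this (div_pos hb hn).le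
  rw [← mul_assoc, div_mul_cancel₀ _ hn.ne'] at this
  linarith

lemma integrable_eval_mul_exp {ι : Type*} [Fintype ι] {V : (ι → ℝ) → ℝ} (hV : Continuous V)
    {b C : ℝ} (hb : 0 < b) (h : ∀ η, b * ‖η‖ ^ 2 - C ≤ V η) (k : ι) :
    Integrable (fun η : ι → ℝ => η k * Real.exp (-V η)) := by
  refine integrable_of_norm_le_gaussian (by fun_prop) (half_pos hb)
    (C := Real.exp (1 / (2 * b) + C)) fun η => ?_
  have h1 : |η k| ≤ ‖η‖ := norm_le_pi_norm η k
  have h2 : |η k| ≤ Real.exp ‖η‖ := h1.trans (by linarith [Real.add_one_le_exp ‖η‖])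
  rw [norm_mul, Real.norm_eq_abs, Real.norm_eq_abs, Real.abs_exp, ← Real.exp_add]
  refine (mul_le_mul_of_nonneg_right h2 (Real.exp_pos _).le).trans ?_
  rw [← Real.exp_add]
  refine Real.exp_le_exp.2 ?_
  have h3 : ‖η‖ ≤ 1 / (2 * b) + b / 2 * ‖η‖ ^ 2 := by
    have : 1 / (2 * b) + b / 2 * ‖η‖ ^ 2 - ‖η‖ = (b * ‖η‖ - 1) ^ 2 / (2 * b) := by
      field_simp
      ring
    have : 0 ≤ (b * ‖η‖ - 1) ^ 2 / (2 * b) := by positivity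
    linarith
  linarith [h η]

lemma integrable_exp {ι : Type*} [Fintype ι] {V : (ι → ℝ) → ℝ} (hV : Continuous V)
    {b C : ℝ} (hb : 0 < b) (h : ∀ η, b * ‖η‖ ^ 2 - C ≤ V η) :
    Integrable (fun η : ι → ℝ => Real.exp (-V η)) := by
  refine integrable_of_norm_le_gaussian (by fun_prop) hb (C := Real.exp C) fun η => ?_
  rw [Real.norm_eq_abs, Real.abs_exp, ← Real.exp_add]
  gcongr
  linarith [h η]

/-- A continuous function homogeneous of degree two and positive away from the origin is bounded
below by a multiple of the squared norm. -/
lemma exists_mul_norm_sq_le {E : Type*} [NormedAddCommGroup E] [NormedSpace ℝ E]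
    [FiniteDimensional ℝ E] {Q : E → ℝ} (hQ : Continuous Q)
    (hhom : ∀ (t : ℝ) x, Q (t • x) = t ^ 2 * Q x) (hpos : ∀ x, x ≠ 0 → 0 < Q x) :
    ∃ c > 0, ∀ x, c * ‖x‖ ^ 2 ≤ Q x := by
  have hzero : Q 0 = 0 := by simpa using hhom 0 0
  rcases subsingleton_or_nontrivial E with hE | hE
  · refine ⟨1, one_pos, fun x => ?_⟩
    rw [Subsingleton.elim x 0, hzero]
    simp
  obtain ⟨u, hu, hmin⟩ := (isCompact_sphere (0 : E) 1).exists_isMinOn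
    (NormedSpace.sphere_nonempty.2 zero_le_one) hQ.continuousOn
  refine ⟨Q u, hpos u (ne_zero_of_mem_unit_sphere ⟨u, hu⟩), fun x => ?_⟩
  rcases eq_or_ne x 0 with rfl | hx
  · simp [hzero]
  have hx' : ‖x‖ ≠ 0 := norm_ne_zero_iff.2 hx
  have hmem : ‖x‖⁻¹ • x ∈ Metric.sphere (0 : E) 1 := by
    simp [norm_smul, hx']
  have hle : Q u ≤ Q (‖x‖⁻¹ • x) := hmin hmem
  have hx2 : Q x = ‖x‖ ^ 2 * Q (‖x‖⁻¹ • x) := by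
    rw [← hhom, smul_smul, mul_inv_cancel₀ hx', one_smul]
  rw [hx2, mul_comm]
  gcongr

end Coercive

section Dirichlet

variable {α : Type*}

/-- The Dirichlet form of the weights `w` on a finite set of sites, over ordered pairs. -/
def dirichlet (B : Finset α) (w : α → α → ℝ) (x : α → ℝ) : ℝ :=
  ∑ i ∈ B, ∑ j ∈ B, w i j * (x i - x j) ^ 2

lemma dirichlet_add_ge {B : Finset α} {w : α → α → ℝ} (hw : ∀ i j, 0 ≤ w i j) (x y : α → ℝ) :
    dirichlet B w x / 2 - dirichlet B w y ≤ dirichlet B w (x + y) := by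
  simp only [dirichlet, Finset.sum_div, ← Finset.sum_sub_distrib]
  refine Finset.sum_le_sum fun i _ => Finset.sum_le_sum fun j _ => ?_
  simp only [Pi.add_apply]
  nlinarith [mul_nonneg (hw i j) (sq_nonneg (x i - x j + 2 * (y i - y j)))]

/-- Completing the square in a single coordinate of the Dirichlet form. -/
lemma dirichlet_update [DecidableEq α] {B : Finset α} {w : α → α → ℝ} {k : α} (hk : k ∈ B)
    (hsymm : ∀ i j, w i j = w j i) (hdiag : w k k = 0) (hsum : ∑ j ∈ B, w k j = 1)
    (x : α → ℝ) (t : ℝ) :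
    dirichlet B w (Function.update x k t) = dirichlet B w x +
      2 * ((t - ∑ j ∈ B, w k j * x j) ^ 2 - (x k - ∑ j ∈ B, w k j * x j) ^ 2) := by
  obtain ⟨A, hA, rfl⟩ : ∃ A, k ∉ A ∧ insert k A = B :=
    ⟨B.erase k, Finset.notMem_erase k B, Finset.insert_erase hk⟩
  have hne : ∀ j ∈ A, j ≠ k := fun j hj h => hA (h ▸ hj)
  have hform : ∀ y : α → ℝ, dirichlet (insert k A) w y =
      2 * ∑ j ∈ A, w k j * (y k - y j) ^ 2 + dirichlet A w y := fun y => by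
    simp only [dirichlet, Finset.sum_insert hA, Finset.sum_add_distrib, hdiag]
    have : ∑ i ∈ A, w i k * (y i - y k) ^ 2 = ∑ j ∈ A, w k j * (y k - y j) ^ 2 :=
      Finset.sum_congr rfl fun j _ => by rw [hsymm j k]; ring
    rw [this]
    ring
  have hrest : dirichlet A w (Function.update x k t) = dirichlet A w x :=
    Finset.sum_congr rfl fun i hi => Finset.sum_congr rfl fun j hj => by
      rw [Function.update_of_ne (hne i hi), Function.update_of_ne (hne j hj)]
  rw [Finset.sum_insert hA, hdiag, zero_add] at hsum
  have hexp : ∀ s : ℝ, ∑ j ∈ A, w k j * (s - x j) ^ 2 =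
      s ^ 2 - 2 * s * ∑ j ∈ A, w k j * x j + ∑ j ∈ A, w k j * x j ^ 2 := fun s => by
    calc ∑ j ∈ A, w k j * (s - x j) ^ 2
        = ∑ j ∈ A, (s ^ 2 * w k j - 2 * s * (w k j * x j) + w k j * x j ^ 2) :=
          Finset.sum_congr rfl fun j _ => by ring
      _ = _ := by
        rw [Finset.sum_add_distrib, Finset.sum_sub_distrib, ← Finset.mul_sum, ← Finset.mul_sum,
          hsum, mul_one]
  have hupd : ∑ j ∈ A, w k j * (Function.update x k t k - Function.update x k t j) ^ 2 =
      ∑ j ∈ A, w k j * (t - x j) ^ 2 := Finset.sum_congr rfl fun j hj => by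
    rw [Function.update_self, Function.update_of_ne (hne j hj)]
  rw [hform, hform, hrest, hupd, hexp, hexp, Finset.sum_insert hA, hdiag]
  ring

lemma continuous_dirichlet {X : Type*} [TopologicalSpace X] (B : Finset α) (w : α → α → ℝ)
    {x : X → α → ℝ} (hx : ∀ i, Continuous fun η => x η i) :
    Continuous fun η => dirichlet B w (x η) :=
  continuous_finsetSum _ fun i _ => continuous_finsetSum _ fun j _ =>
    continuous_const.mul (((hx i).sub (hx j)).pow 2)

/-- The weights of the pairs meeting `Λ`. -/
noncomputable def pairWeight [DecidableEq α] (p : α → α → ℝ) (Λ : Finset α) (i j : α) : ℝ :=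
  if i ∈ Λ ∨ j ∈ Λ then p i j else 0

lemma matPow_nonneg {p : α → α → ℝ} (hnn : ∀ i j, 0 ≤ p i j) (n : ℕ) (i j : α) :
    0 ≤ matPow p n i j := by
  induction n generalizing j with
  | zero =>
    simp only [matPow]
    split_ifs <;> norm_num
  | succ n ih => exact tsum_nonneg fun l => mul_nonneg (ih l) (hnn l j)

/-- A set closed under the positive transitions of `p` is closed under those of its powers. -/
lemma mem_of_matPow_pos {p : α → α → ℝ} (hnn : ∀ i j, 0 ≤ p i j) {S : Set α}
    (hS : ∀ i ∈ S, ∀ j, p i j ≠ 0 → j ∈ S) {i : α} (hi : i ∈ S) (n : ℕ) (j : α)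
    (hpos : 0 < matPow p n i j) : j ∈ S := by
  induction n generalizing j with
  | zero =>
    simp only [matPow] at hpos
    split_ifs at hpos with h
    · exact h ▸ hi
    · exact absurd hpos (lt_irrefl _)
  | succ n ih =>
    obtain ⟨l, hl⟩ : ∃ l, matPow p n i l * p l j ≠ 0 := by
      by_contra! h
      simp [matPow, h] at hpos
    have hl' := mul_ne_zero_iff.1 hl
    exact hS l (ih l ((matPow_nonneg hnn n i l).lt_of_ne' hl'.1)) j hl'.2

lemma eq_zero_of_dirichlet_eq_zero [DecidableEq α] [Infinite α] {p : α → α → ℝ}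
    (hnn : ∀ i j, 0 ≤ p i j) (hirr : ∀ i j, ∃ n : ℕ, 0 < matPow p n i j) {Λ B : Finset α}
    (hΛB : Λ ⊆ B) (hB : ∀ i ∈ Λ, ∀ j, p i j ≠ 0 → j ∈ B) {x : α → ℝ} (hx : ∀ i ∉ Λ, x i = 0)
    (h : dirichlet B (pairWeight p Λ) x = 0) : x = 0 := by
  have hterm : ∀ i j, 0 ≤ pairWeight p Λ i j * (x i - x j) ^ 2 := fun i j => by
    refine mul_nonneg ?_ (sq_nonneg _)
    rw [pairWeight]
    split_ifs
    exacts [hnn i j, le_rfl]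
  have hedge : ∀ i ∈ Λ, ∀ j, p i j ≠ 0 → x j = x i := fun i hi j hij => by
    have h1 := (Finset.sum_eq_zero_iff_of_nonneg
      fun i _ => Finset.sum_nonneg fun j _ => hterm i j).1 h i (hΛB hi)
    have h2 := (Finset.sum_eq_zero_iff_of_nonneg fun j _ => hterm i j).1 h1 j (hB i hi j hij)
    rw [pairWeight, if_pos (Or.inl hi)] at h2
    have h3 := pow_eq_zero_iff two_ne_zero |>.1 ((mul_eq_zero.1 h2).resolve_left hij)
    linarith
  funext i
  by_contra hi
  obtain ⟨j, hj⟩ := Infinite.exists_notMem_finset Λ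
  obtain ⟨n, hn⟩ := hirr i j
  have hmem : x j = x i := by
    refine mem_of_matPow_pos hnn (S := {l | x l = x i}) (fun l hl q hlq => ?_) rfl n j hn
    have hlmem : l ∈ Λ := by
      by_contra hlΛ
      exact hi (hl.symm.trans (hx l hlΛ))
    exact (hedge l hlmem q hlq).trans hl
  exact hi (hmem.symm.trans (hx j hj))

/-- The configuration equal to `η` on `Λ` and to `γ` off `Λ`. -/
def juxtapose [DecidableEq α] (Λ : Finset α) (γ : α → ℝ) (η : Λ → ℝ) (j : α) : ℝ :=
  if h : j ∈ Λ then η ⟨j, h⟩ else γ j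

lemma continuous_juxtapose [DecidableEq α] (Λ : Finset α) (γ : α → ℝ) (j : α) :
    Continuous fun η => juxtapose Λ γ η j := by
  unfold juxtapose
  split_ifs
  exacts [continuous_apply _, continuous_const]

lemma juxtapose_update [DecidableEq α] {Λ : Finset α} (γ : α → ℝ) (η : Λ → ℝ) (k : Λ) (t : ℝ) :
    juxtapose Λ γ (Function.update η k t) = Function.update (juxtapose Λ γ η) k t := by
  funext j
  by_cases hj : j = k
  · subst hj
    simp [juxtapose]
  · by_cases hΛ : j ∈ Λ
    · have : (⟨j, hΛ⟩ : Λ) ≠ k := fun h => hj (congrArg Subtype.val h)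
      simp [juxtapose, hΛ, Function.update_of_ne hj, Function.update_of_ne this]
    · simp [juxtapose, hΛ, Function.update_of_ne hj]

lemma dirichlet_juxtapose_coercive [DecidableEq α] [Infinite α] {p : α → α → ℝ}
    (hnn : ∀ i j, 0 ≤ p i j) (hirr : ∀ i j, ∃ n : ℕ, 0 < matPow p n i j) {Λ B : Finset α}
    (hΛB : Λ ⊆ B) (hB : ∀ i ∈ Λ, ∀ j, p i j ≠ 0 → j ∈ B) (γ : α → ℝ) :
    ∃ b > 0, ∃ C, ∀ η, b * ‖η‖ ^ 2 - C ≤ dirichlet B (pairWeight p Λ) (juxtapose Λ γ η) := by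
  have hw : ∀ i j, 0 ≤ pairWeight p Λ i j := fun i j => by
    rw [pairWeight]
    split_ifs
    exacts [hnn i j, le_rfl]
  obtain ⟨c, hc, hle⟩ := exists_mul_norm_sq_le
    (Q := fun η : Λ → ℝ => dirichlet B (pairWeight p Λ) (juxtapose Λ 0 η))
    (continuous_dirichlet B _ (continuous_juxtapose Λ 0)) (fun t η => by
      have : juxtapose Λ 0 (t • η) = t • juxtapose Λ 0 η := by
        funext j
        by_cases hj : j ∈ Λ <;> simp [juxtapose, hj]
      simp only [this, dirichlet, Finset.mul_sum, Pi.smul_apply, smul_eq_mul]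
      exact Finset.sum_congr rfl fun i _ => Finset.sum_congr rfl fun j _ => by ring)
    (fun η hη => by
      refine (Finset.sum_nonneg fun i _ => Finset.sum_nonneg fun j _ =>
        mul_nonneg (hw i j) (sq_nonneg _)).lt_of_ne' fun h => hη ?_
      have hzero := eq_zero_of_dirichlet_eq_zero hnn hirr hΛB hB
        (fun i hi => by simp [juxtapose, hi]) h
      funext i
      simpa [juxtapose] using congrFun hzero i)
  refine ⟨c / 2, half_pos hc, dirichlet B (pairWeight p Λ) (juxtapose Λ γ 0), fun η => ?_⟩
  have hsplit : juxtapose Λ γ η = juxtapose Λ 0 η + juxtapose Λ γ 0 := by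
    funext j
    by_cases hj : j ∈ Λ <;> simp [juxtapose, hj]
  rw [hsplit]
  linarith [hle η, dirichlet_add_ge (B := B) hw (juxtapose Λ 0 η) (juxtapose Λ γ 0)]

lemma tsum_pairs_eq_dirichlet [DecidableEq α] {p : α → α → ℝ} (hsymm : ∀ i j, p i j = p j i)
    {Λ B : Finset α} (hΛB : Λ ⊆ B) (hB : ∀ i ∈ Λ, ∀ j, p i j ≠ 0 → j ∈ B) (x : α → ℝ) :
    (∑' ij : α × α, if ij.1 ≠ ij.2 ∧ (ij.1 ∈ Λ ∨ ij.2 ∈ Λ)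
      then p ij.1 ij.2 * (x ij.1 - x ij.2) ^ 2 else 0) = dirichlet B (pairWeight p Λ) x := by
  rw [tsum_eq_sum (s := B ×ˢ B), Finset.sum_product]
  · refine Finset.sum_congr rfl fun i _ => Finset.sum_congr rfl fun j _ => ?_
    by_cases hij : i = j
    · simp [hij]
    · by_cases h : i ∈ Λ ∨ j ∈ Λ <;> simp [pairWeight, hij, h]
  · rintro ⟨i, j⟩ hij
    refine ite_eq_right_iff.2 fun h => ?_
    suffices p i j = 0 by simp [this]
    by_contra hp
    refine hij (Finset.mem_product.2 ?_)
    rcases h.2 with hi | hj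
    · exact ⟨hΛB hi, hB i hi j hp⟩
    · exact ⟨hB j hj i (hsymm i j ▸ hp), hΛB hj⟩

end Dirichlet

lemma exists_finset_neighbors {d : ℕ} {p : (Fin d → ℤ) → (Fin d → ℤ) → ℝ}
    (htrans : ∀ i j, p i j = p 0 (j - i))
    (hrange : ∃ v : ℝ, ∀ j : Fin d → ℤ, v < ‖j‖ → p 0 j = 0) (Λ : Finset (Fin d → ℤ)) :
    ∃ B : Finset (Fin d → ℤ), Λ ⊆ B ∧ ∀ i ∈ Λ, ∀ j, p i j ≠ 0 → j ∈ B := by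
  obtain ⟨v, hv⟩ := hrange
  have hfin : ∀ i : Fin d → ℤ, (Metric.closedBall i v).Finite := fun i =>
    (isCompact_closedBall i v).finite_of_discrete
  refine ⟨Λ ∪ Λ.biUnion fun i => (hfin i).toFinset, Finset.subset_union_left,
    fun i hi j hij => Finset.mem_union_right _ (Finset.mem_biUnion.2 ⟨i, hi, ?_⟩)⟩
  rw [Set.Finite.mem_toFinset, Metric.mem_closedBall, dist_eq_norm]
  by_contra! h
  exact hij (htrans i j ▸ hv _ h)

/-- The normalized Boltzmann weight of a coercive potential defines a finite measure with
integrable coordinates. -/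
lemma gibbs_integrable {ι : Type*} [Fintype ι] {V : (ι → ℝ) → ℝ} (hV : Continuous V)
    {b C : ℝ} (hb : 0 < b) (h : ∀ η, b * ‖η‖ ^ 2 - C ≤ V η) {Z : ENNReal}
    (hZ : Z = ∫⁻ η : ι → ℝ, ENNReal.ofReal (Real.exp (-V η))) :
    IsFiniteMeasure (volume.withDensity fun η => ENNReal.ofReal (Real.exp (-V η)) / Z) ∧
      ∀ k, Integrable (fun η : ι → ℝ => η k)
        (volume.withDensity fun η => ENNReal.ofReal (Real.exp (-V η)) / Z) := by
  have hmeas : Measurable fun η : ι → ℝ => ENNReal.ofReal (Real.exp (-V η)) := by fun_prop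
  have hZtop : Z ≠ ⊤ := by
    rw [hZ]
    exact (integrable_exp hV hb h).lintegral_lt_top.ne
  have hZ0 : Z ≠ 0 := by
    rw [hZ, Ne, lintegral_eq_zero_iff hmeas]
    intro h0
    obtain ⟨η, hη⟩ := h0.exists
    exact (ENNReal.ofReal_pos.2 (Real.exp_pos _)).ne' hη
  refine ⟨isFiniteMeasure_withDensity ?_, fun k => ?_⟩
  · simp only [div_eq_mul_inv]
    rw [lintegral_mul_const _ hmeas, ← hZ]
    exact ENNReal.mul_ne_top hZtop (ENNReal.inv_ne_top.2 hZ0)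
  · rw [integrable_withDensity_iff_integrable_smul' (hmeas.div_const Z)
      (Filter.Eventually.of_forall fun η => ENNReal.div_lt_top ENNReal.ofReal_ne_top hZ0)]
    refine ((integrable_eval_mul_exp hV hb h k).mul_const Z.toReal⁻¹).congr
      (Filter.Eventually.of_forall fun η => ?_)
    beta_reduce
    rw [ENNReal.toReal_div, ENNReal.toReal_ofReal (Real.exp_pos _).le, smul_eq_mul]
    ring

end Harness


/-- The finite-volume Gaussian Gibbs measure is a harness: the conditional expectation of the
height at `k` given the other coordinates is the `p`-average of the neighboring heights. -/
theorem stmt4 (d : ℕ) (hd : 1 ≤ d)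
    (p : (Fin d → ℤ) → (Fin d → ℤ) → ℝ)
    (hnn : ∀ i j, 0 ≤ p i j)
    (hstoch : ∀ i, ∑' j, p i j = 1)
    (hsymm : ∀ i j, p i j = p j i)
    (htrans : ∀ i j, p i j = p 0 (j - i))
    (hdiag : ∀ i, p i i = 0)
    (hrange : ∃ v : ℝ, ∀ j : Fin d → ℤ, v < ‖j‖ → p 0 j = 0)
    (hirr : ∀ i j, ∃ n : ℕ, 0 < matPow p n i j)
    (Λ : Finset (Fin d → ℤ)) (γ : (Fin d → ℤ) → ℝ) (σ : ℝ) (hσ : 0 < σ)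
    -- `jux η` is the configuration equal to `η` on `Λ` and to `γ` off `Λ`
    (jux : (Λ → ℝ) → (Fin d → ℤ) → ℝ)
    (hjux : ∀ η j, jux η j = if h : j ∈ Λ then η ⟨j, h⟩ else γ j)
    -- the Hamiltonian: the sum over unordered pairs of distinct sites meeting `Λ`
    -- is written as half the sum over ordered pairs
    (H : (Λ → ℝ) → ℝ)
    (hH : ∀ η, H η = (1 / (2 * σ ^ 2)) * ((1 / 2) *
      ∑' ij : ((Fin d → ℤ) × (Fin d → ℤ)),
        if ij.1 ≠ ij.2 ∧ (ij.1 ∈ Λ ∨ ij.2 ∈ Λ)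
        then p ij.1 ij.2 * (jux η ij.1 - jux η ij.2) ^ 2 else 0))
    -- the partition function and the finite-volume Gibbs measure `μ^{Λ,γ}`
    (Z : ENNReal)
    (hZ : Z = ∫⁻ η : Λ → ℝ, ENNReal.ofReal (Real.exp (-(H η))))
    (μ : Measure (Λ → ℝ))
    (hμ : μ = volume.withDensity fun η => ENNReal.ofReal (Real.exp (-(H η))) / Z)
    (k : Λ)
    -- the σ-algebra generated by the coordinates off `k`
    (m : MeasurableSpace (Λ → ℝ))
    (hm : m = MeasurableSpace.comap
      (fun (η : Λ → ℝ) (j : {j : Λ // j ≠ k}) => η (j : Λ)) inferInstance) :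
    Integrable (fun η : Λ → ℝ => η k) μ
      ∧ μ[(fun η : Λ → ℝ => η k) | m]
          =ᵐ[μ] fun η : Λ → ℝ => ∑' j : Fin d → ℤ, p (k : Fin d → ℤ) j * jux η j := by
  classical
  subst hm
  obtain ⟨B, hΛB, hB⟩ := Harness.exists_finset_neighbors htrans hrange Λ
  have : Nonempty (Fin d) := ⟨⟨0, hd⟩⟩
  obtain rfl : jux = Harness.juxtapose Λ γ := by
    funext η j
    rw [hjux, Harness.juxtapose]
  set w := Harness.pairWeight p Λ with hw
  have hHd : ∀ η, H η =
      1 / (4 * σ ^ 2) * Harness.dirichlet B w (Harness.juxtapose Λ γ η) := fun η => by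
    rw [← Harness.tsum_pairs_eq_dirichlet hsymm hΛB hB, hH]
    ring
  obtain ⟨b, hb, C, hcoer⟩ := Harness.dirichlet_juxtapose_coercive hnn hirr hΛB hB γ
  have hHcont : Continuous H := by
    rw [funext hHd]
    exact continuous_const.mul
      (Harness.continuous_dirichlet B w (Harness.continuous_juxtapose Λ γ))
  have hHcoer : ∀ η, 1 / (4 * σ ^ 2) * b * ‖η‖ ^ 2 - 1 / (4 * σ ^ 2) * C ≤ H η := fun η => by
    rw [hHd, mul_assoc, ← mul_sub]
    exact mul_le_mul_of_nonneg_left (hcoer η) (by positivity)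
  obtain ⟨hfin, hint⟩ := Harness.gibbs_integrable hHcont (by positivity) hHcoer hZ
  rw [← hμ] at hfin hint
  have hout : ∀ j ∉ B, p k j = 0 := fun j hj => by
    by_contra h
    exact hj (hB k k.2 j h)
  have hwk : ∀ j, w k j = p k j := fun j => if_pos (Or.inl k.2)
  have hwsymm : ∀ i j, w i j = w j i := fun i j => by
    simp only [hw, Harness.pairWeight, hsymm i j, or_comm]
  have hwsum : ∑ j ∈ B, w k j = 1 := by
    simp only [hwk]
    rw [← hstoch k, tsum_eq_sum hout]
  let fill (y : {j : Λ // j ≠ k} → ℝ) (j : Λ) : ℝ := if h : j ≠ k then y ⟨j, h⟩ else 0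
  let G (y : {j : Λ // j ≠ k} → ℝ) : ℝ := ∑ j ∈ B, w k j * Harness.juxtapose Λ γ (fill y) j
  have hGmeas : Measurable G := by
    refine Finset.measurable_fun_sum _ fun j _ => Measurable.const_mul ?_ _
    refine (Harness.continuous_juxtapose Λ γ j).measurable.comp
      (measurable_pi_lambda _ fun i => ?_)
    by_cases h : i ≠ k
    · simp only [fill, dif_pos h]
      exact measurable_pi_apply _
    · simp only [fill, dif_neg h]
      exact measurable_const
  have hGsum : ∀ η : Λ → ℝ,
      G (fun j => η j) = ∑ j ∈ B, w k j * Harness.juxtapose Λ γ η j := fun η => by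
    refine Finset.sum_congr rfl fun j _ => ?_
    by_cases hj : j = k
    · rw [hj, hwk, hdiag, zero_mul, zero_mul]
    · by_cases hΛ : j ∈ Λ
      · have hne : (⟨j, hΛ⟩ : Λ) ≠ k := fun h => hj (congrArg Subtype.val h)
        simp [Harness.juxtapose, fill, hΛ, hne]
      · simp [Harness.juxtapose, hΛ]
  have hHrefl : ∀ η, H (Harness.reflect k G η) = H η := fun η => by
    have hk : Harness.juxtapose Λ γ η k = η k := by simp [Harness.juxtapose]
    rw [hHd, hHd, Harness.reflect, Harness.juxtapose_update,
      Harness.dirichlet_update (hΛB k.2) hwsymm (by rw [hwk, hdiag]) hwsum, ← hGsum, hk]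
    ring
  have hT : MeasurePreserving (Harness.reflect k G) μ μ := by
    rw [hμ]
    refine (Harness.volume_preserving_reflect hGmeas).withDensity_of_comp_eq ?_
      fun η => by rw [hHrefl]
    exact Measurable.div_const (by fun_prop) Z
  refine ⟨hint k, ?_⟩
  refine (Harness.condExp_eval_of_reflect hGmeas hT (hint k)).trans
    (Filter.Eventually.of_forall fun η => ?_)
  simp only [hGsum, hwk]
  exact (tsum_eq_sum fun j hj => by rw [hout j hj, zero_mul]).symm
end

section
/- Well-definedness of the finite-volume Gibbs measures (normalizability of the local specifications (p71)): Let p be a symmetric translation-invariant finite-range stochastic matrix with zero diagonal on ℤ^d which is irreducible. Then for every finite Λ ⊂ ℤ^d, every boundary condition γ ∈ ℝ^{ℤ^d} and every σ > 0, the partition function is finite and positive: 0 < ∫_{ℝ^Λ} e^{−H^{Λ,γ}(η)} dη < ∞. -/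
open MeasureTheory ProbabilityTheory

/-- If a positive entry of a matrix power leads from `i` to `j`, then any property of sites that
propagates backwards along positive entries of `p` passes from `j` to `i`. -/
theorem of_matPow_pos {α : Type*} {p : α → α → ℝ} (hnn : ∀ i j, 0 ≤ p i j) {P : α → Prop}
    (hP : ∀ i k, 0 < p i k → P k → P i) (n : ℕ) :
    ∀ i j, 0 < matPow p n i j → P j → P i := by
  induction n with
  | zero =>
    intro i j h hj
    simp only [matPow] at h
    split_ifs at h with hij
    · exact hij ▸ hj
    · exact absurd h (lt_irrefl _)
  | succ n ih =>
    intro i j h hj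
    simp only [matPow] at h
    obtain ⟨k, hk⟩ : ∃ k, 0 < matPow p n i k * p k j := by
      by_contra! hle
      exact absurd h (not_lt.mpr (tsum_nonpos hle))
    have hkj : 0 < p k j := (hnn k j).lt_of_ne fun h0 => by simp [← h0] at hk
    exact ih i k (pos_of_mul_pos_left hk hkj.le) (hP k j hkj hj)

/-- A finite-range translation-invariant kernel has finitely many nonzero entries in each row. -/
theorem finite_setOf_ne_zero {d : ℕ} {p : (Fin d → ℤ) → (Fin d → ℤ) → ℝ}
    (htrans : ∀ i j, p i j = p 0 (j - i))
    (hrange : ∃ v : ℝ, ∀ j : Fin d → ℤ, v < ‖j‖ → p 0 j = 0) (i : Fin d → ℤ) :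
    {j | p i j ≠ 0}.Finite := by
  obtain ⟨v, hv⟩ := hrange
  refine (isCompact_closedBall i v).finite_of_discrete.subset fun j hj => ?_
  rw [Metric.mem_closedBall, dist_eq_norm]
  by_contra! h
  exact hj ((htrans i j).trans (hv _ h))

/-- A kernel with finite rows and columns has finitely many nonzero entries meeting a finite
set. -/
theorem finite_setOf_pair_ne_zero {α : Type*} {p : α → α → ℝ} (hsymm : ∀ i j, p i j = p j i)
    (hfin : ∀ i, {j | p i j ≠ 0}.Finite) (Λ : Finset α) :
    {ij : α × α | (ij.1 ∈ Λ ∨ ij.2 ∈ Λ) ∧ p ij.1 ij.2 ≠ 0}.Finite := by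
  have hN : (⋃ i ∈ Λ, {j | p i j ≠ 0}).Finite := Λ.finite_toSet.biUnion fun i _ => hfin i
  refine ((Λ.finite_toSet.prod hN).union (hN.prod Λ.finite_toSet)).subset ?_
  rintro ⟨i, j⟩ ⟨hi | hj, hp⟩
  · exact Or.inl ⟨hi, Set.mem_biUnion hi hp⟩
  · exact Or.inr ⟨Set.mem_biUnion hj (show p j i ≠ 0 from hsymm i j ▸ hp), hj⟩

/-- If `∑ i, η i ^ 2` is bounded by an affine function of `H`, then `exp (-H)` has finite
integral. -/
theorem lintegral_exp_neg_lt_top {ι : Type*} [Fintype ι] {H : (ι → ℝ) → ℝ} {A B : ℝ}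
    (hB : 0 < B) (h : ∀ η, ∑ i, η i ^ 2 ≤ A + B * H η) :
    ∫⁻ η, ENNReal.ofReal (Real.exp (-(H η))) < ⊤ := by
  have hint : Integrable fun η : ι → ℝ =>
      Real.exp (A / B) * ∏ i, Real.exp (-B⁻¹ * η i ^ 2) :=
    (Integrable.fintype_prod (f := fun _ x => Real.exp (-B⁻¹ * x ^ 2)) fun _ =>
      integrable_exp_neg_mul_sq (inv_pos.mpr hB)).const_mul _
  refine lt_of_le_of_lt (lintegral_mono fun η => ENNReal.ofReal_le_ofReal ?_)
    hint.lintegral_lt_top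
  rw [← Real.exp_sum, ← Real.exp_add, Real.exp_le_exp, ← Finset.mul_sum]
  have := mul_le_mul_of_nonneg_left (h η) (inv_pos.mpr hB).le
  rw [mul_add, inv_mul_cancel_left₀ hB.ne'] at this
  rw [div_eq_inv_mul]
  linarith

/-- Well-definedness of the finite-volume Gibbs measures: the partition function
`Z^{Λ,γ} = ∫ e^{-H^{Λ,γ}} dη` is finite and positive. -/
theorem stmt6 (d : ℕ) (hd : 1 ≤ d)
    (p : (Fin d → ℤ) → (Fin d → ℤ) → ℝ)
    (hnn : ∀ i j, 0 ≤ p i j)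
    (hstoch : ∀ i, ∑' j, p i j = 1)
    (hsymm : ∀ i j, p i j = p j i)
    (htrans : ∀ i j, p i j = p 0 (j - i))
    (hdiag : ∀ i, p i i = 0)
    (hrange : ∃ v : ℝ, ∀ j : Fin d → ℤ, v < ‖j‖ → p 0 j = 0)
    (hirr : ∀ i j, ∃ n : ℕ, 0 < matPow p n i j)
    (Λ : Finset (Fin d → ℤ)) (γ : (Fin d → ℤ) → ℝ) (σ : ℝ) (hσ : 0 < σ)
    -- `jux η` is the configuration equal to `η` on `Λ` and to `γ` off `Λ`
    (jux : (Λ → ℝ) → (Fin d → ℤ) → ℝ)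
    (hjux : ∀ η j, jux η j = if h : j ∈ Λ then η ⟨j, h⟩ else γ j)
    -- the Hamiltonian: the sum over unordered pairs of distinct sites meeting `Λ`
    -- is written as half the sum over ordered pairs
    (H : (Λ → ℝ) → ℝ)
    (hH : ∀ η, H η = (1 / (2 * σ ^ 2)) * ((1 / 2) *
      ∑' ij : ((Fin d → ℤ) × (Fin d → ℤ)),
        if ij.1 ≠ ij.2 ∧ (ij.1 ∈ Λ ∨ ij.2 ∈ Λ)
        then p ij.1 ij.2 * (jux η ij.1 - jux η ij.2) ^ 2 else 0))
    :
    0 < ∫⁻ η : Λ → ℝ, ENNReal.ofReal (Real.exp (-(H η)))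
      ∧ ∫⁻ η : Λ → ℝ, ENNReal.ofReal (Real.exp (-(H η))) < ⊤ := by
  have : Nonempty (Fin d) := ⟨⟨0, hd⟩⟩
  set F : (Λ → ℝ) → (Fin d → ℤ) × (Fin d → ℤ) → ℝ := fun η ij =>
    if ij.1 ≠ ij.2 ∧ (ij.1 ∈ Λ ∨ ij.2 ∈ Λ)
    then p ij.1 ij.2 * (jux η ij.1 - jux η ij.2) ^ 2 else 0 with hF
  have hF0 : ∀ η ij, 0 ≤ F η ij := fun η ij => by
    simp only [hF]
    split_ifs
    · exact mul_nonneg (hnn _ _) (sq_nonneg _)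
    · exact le_rfl
  have hfin := finite_setOf_pair_ne_zero hsymm (finite_setOf_ne_zero htrans hrange) Λ
  have hFzero : ∀ η, ∀ ij ∉ hfin.toFinset, F η ij = 0 := fun η ij hij => by
    simp only [hF]
    split_ifs with hc
    · have : p ij.1 ij.2 = 0 := by
        by_contra h0
        exact hij (hfin.mem_toFinset.mpr ⟨hc.2, h0⟩)
      rw [this, zero_mul]
    · rfl
  have hFsum : ∀ η, Summable (F η) := fun η => summable_of_ne_finset_zero (hFzero η)
  have hHF : ∀ η, ∑' ij, F η ij = 4 * σ ^ 2 * H η := fun η => by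
    rw [hH η]
    field_simp
    ring
  have hjm : ∀ j, Measurable fun η => jux η j := fun j => by
    simp only [hjux]
    split_ifs
    · exact measurable_pi_apply _
    · exact measurable_const
  have hHm : Measurable H := by
    have : H = fun η => (1 / (2 * σ ^ 2)) * ((1 / 2) * ∑ ij ∈ hfin.toFinset, F η ij) :=
      funext fun η => by
        rw [hH η, ← tsum_eq_sum (L := .unconditional _) (hFzero η)]
    rw [this]
    refine ((Finset.measurable_sum _ fun ij _ => ?_).const_mul _).const_mul _
    simp only [hF]
    split_ifs
    · exact (((hjm _).sub (hjm _)).pow_const 2).const_mul _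
    · exact measurable_const
  have hH0 : ∀ η, 0 ≤ H η := fun η => by
    have := hHF η ▸ tsum_nonneg (hF0 η)
    exact nonneg_of_mul_nonneg_right this (by positivity)
  constructor
  · rw [lintegral_pos_iff_support (hHm.fun_neg.exp).ennreal_ofReal]
    have : (Function.support fun η => ENNReal.ofReal (Real.exp (-(H η)))) = Set.univ :=
      Set.eq_univ_of_forall fun η => by simp [Real.exp_pos]
    rw [this]
    exact Measure.measure_univ_pos.mpr (NeZero.ne _)
  · have hbound : ∀ i, ∃ A B : ℝ, 0 ≤ B ∧ ∀ η, jux η i ^ 2 ≤ A + B * H η := by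
      obtain ⟨j, hj⟩ := Infinite.exists_notMem_finset Λ
      have hout : ∀ i ∉ Λ, ∃ A B : ℝ, 0 ≤ B ∧ ∀ η, jux η i ^ 2 ≤ A + B * H η :=
        fun i hi => ⟨γ i ^ 2, 0, le_rfl, fun η => by simp [hjux, hi]⟩
      intro i
      obtain ⟨n, hn⟩ := hirr i j
      refine of_matPow_pos hnn
        (P := fun i => ∃ A B : ℝ, 0 ≤ B ∧ ∀ η, jux η i ^ 2 ≤ A + B * H η) (fun i k hik => ?_) n i j hn (hout j hj)
      rintro ⟨A, B, hB, hk⟩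
      by_cases hi : i ∈ Λ
      · refine ⟨2 * A, 2 * B + 2 * (4 * σ ^ 2 / p i k), by positivity, fun η => ?_⟩
        have hne : i ≠ k := fun h => by simp [h, hdiag] at hik
        have hle : p i k * (jux η i - jux η k) ^ 2 ≤ 4 * σ ^ 2 * H η := by
          rw [← hHF η]
          refine le_trans (le_of_eq ?_) ((hFsum η).le_tsum (i, k) fun ij _ => hF0 η ij)
          simp [hF, hne, hi]
        have hle' : (jux η i - jux η k) ^ 2 ≤ 4 * σ ^ 2 / p i k * H η := by
          rw [div_mul_eq_mul_div, le_div_iff₀ hik]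
          linarith
        nlinarith [hk η, sq_nonneg (jux η i - 2 * jux η k)]
      · exact hout i hi
    choose A B hB hAB using hbound
    refine lintegral_exp_neg_lt_top (A := ∑ i : Λ, A i) (B := ∑ i : Λ, B i + 1)
      (add_pos_of_nonneg_of_pos (Finset.sum_nonneg fun i _ => hB i) one_pos) fun η => ?_
    have : ∑ i : Λ, η i ^ 2 ≤ ∑ i : Λ, (A i + B i * H η) :=
      Finset.sum_le_sum fun i _ => by simpa [hjux] using hAB i η
    rw [Finset.sum_add_distrib, ← Finset.sum_mul] at this
    linarith [hH0 η]
end
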